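/- Let V = ℝ⁶ with basis e₁,…,e₆ and volume form θ = e₁* ∧ ⋯ ∧ e₆*. A 3-form ω satisfies λ(ω) > 0 if and only if ω lies in the GL(6,ℝ)-orbit of e₁* ∧ e₂* ∧ e₃* + e₄* ∧ e₅* ∧ e₆*. -/

import Mathlib

/- Framework: exterior forms on a real vector space `V` are modelled as elements of the
exterior algebra of the dual space; a `k`-form is an element of the submodule
`⋀[ℝ]^k (Module.Dual ℝ V)`, and the wedge product is the algebra multiplication. -/

noncomputable section
open ExteriorAlgebra
set_option synthInstance.maxHeartbeats 1000000
set_option maxHeartbeats 1000000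

variable (V : Type) [AddCommGroup V] [Module ℝ V]

/-- The algebra of exterior forms on `V`. -/
abbrev EForm := ExteriorAlgebra ℝ (Module.Dual ℝ V)

variable {V}

/-- Interior product (contraction) of forms by a vector, linear in the vector. -/
def iContrL : V →ₗ[ℝ] Module.End ℝ (EForm V) :=
  (CliffordAlgebra.contractLeft (Q := (0 : QuadraticForm ℝ (Module.Dual ℝ V)))).comp
    (Module.Dual.eval ℝ V)

/-- Contraction of forms by an arbitrary element of the exterior algebra of `V`
(e.g. by a bivector), extending `iContrL` as an algebra morphism. -/
def aContr : ExteriorAlgebra ℝ V →ₐ[ℝ] Module.End ℝ (EForm V) :=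
  ExteriorAlgebra.lift ℝ ⟨iContrL, fun _ =>
    LinearMap.ext fun _ => CliffordAlgebra.contractLeft_contractLeft _ _⟩

/-- The bilinear form on `V` associated with an exterior 2-form, via double contraction
(the scalar part is extracted by `ExteriorAlgebra.algebraMapInv`). -/
def formToBilin (Om : EForm V) : V →ₗ[ℝ] V →ₗ[ℝ] ℝ :=
  LinearMap.mk₂ ℝ (fun x y => algebraMapInv (iContrL y (iContrL x Om)))
    (fun x x' y => by simp [map_add, LinearMap.add_apply])
    (fun c x y => by simp [map_smul, LinearMap.smul_apply])
    (fun x y y' => by simp [map_add, LinearMap.add_apply])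
    (fun c x y => by simp [map_smul, LinearMap.smul_apply])

/-- A 2-form is nondegenerate (symplectic) if its associated bilinear form is. -/
def IsSymplecticForm (Om : EForm V) : Prop :=
  Om ∈ ⋀[ℝ]^2 (Module.Dual ℝ V) ∧ ∀ x : V, (∀ y : V, formToBilin Om x y = 0) → x = 0

/-- The algebra morphism `⋀ V → ⋀ V*` induced by a linear map `Γ : V → V*`. -/
def extAlgMap (f : V →ₗ[ℝ] Module.Dual ℝ V) : ExteriorAlgebra ℝ V →ₐ[ℝ] EForm V :=
  ExteriorAlgebra.lift ℝ ⟨(ExteriorAlgebra.ι ℝ).comp f, fun _ => ι_sq_zero _⟩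

/-- `XOm` is the bivector dual to the symplectic form `Om`, i.e. the unique bivector with
`Γ^*(X_Ω) = Ω` where `Γ : V → V*` is the isomorphism induced by `Om`. -/
def IsDualBivector (Om : EForm V) (XOm : ExteriorAlgebra ℝ V) : Prop :=
  XOm ∈ ⋀[ℝ]^2 V ∧ extAlgMap (formToBilin Om) XOm = Om

/-- The pullback action on forms induced by an endomorphism `K : V → V`. -/
def formPullback (K : V →ₗ[ℝ] V) : EForm V →ₐ[ℝ] EForm V :=
  ExteriorAlgebra.lift ℝ ⟨(ExteriorAlgebra.ι ℝ).comp K.dualMap, fun _ => ι_sq_zero _⟩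


/-- The `i`-th coordinate 1-form `eᵢ*` on `ℝ⁶`, as an element of the exterior algebra. -/
def e6 (i : Fin 6) : EForm (Fin 6 → ℝ) :=
  ExteriorAlgebra.ι ℝ ((Pi.basisFun ℝ (Fin 6)).coord i)

/-- The standard volume form `θ = e₁* ∧ ⋯ ∧ e₆*` on `ℝ⁶`. -/
def vol6 : EForm (Fin 6 → ℝ) := e6 0 * e6 1 * e6 2 * e6 3 * e6 4 * e6 5

/-- The model 3-form `e₁* ∧ e₂* ∧ e₃* + e₄* ∧ e₅* ∧ e₆*`. -/
def omegaModel : EForm (Fin 6 → ℝ) := e6 0 * e6 1 * e6 2 + e6 3 * e6 4 * e6 5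

section Contraction

lemma iContrL_ι_mul (X : V) (α : Module.Dual ℝ V) (x : EForm V) :
    iContrL X (ι ℝ α * x) = α X • x - ι ℝ α * iContrL X x :=
  CliffordAlgebra.contractLeft_ι_mul (Q := (0 : QuadraticForm ℝ (Module.Dual ℝ V))) _ _ _

lemma iContrL_ι (X : V) (α : Module.Dual ℝ V) :
    iContrL X (ι ℝ α) = algebraMap ℝ (EForm V) (α X) :=
  CliffordAlgebra.contractLeft_ι (Q := (0 : QuadraticForm ℝ (Module.Dual ℝ V))) _ _

lemma iContrL_algebraMap (X : V) (r : ℝ) : iContrL X (algebraMap ℝ (EForm V) r) = 0 :=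
  CliffordAlgebra.contractLeft_algebraMap (Q := (0 : QuadraticForm ℝ (Module.Dual ℝ V))) _ _

lemma iContrL_comm (X Y : V) (x : EForm V) :
    iContrL X (iContrL Y x) = -iContrL Y (iContrL X x) :=
  CliffordAlgebra.contractLeft_comm (Q := (0 : QuadraticForm ℝ (Module.Dual ℝ V))) _ _ _

lemma mem_exteriorPower_induction {C : ℕ → EForm V → Prop}
    (algebraMap : ∀ r : ℝ, C 0 (algebraMap ℝ (EForm V) r))
    (add : ∀ n x y, C n x → C n y → C n (x + y))
    (ι_mul : ∀ (α : Module.Dual ℝ V) n x, x ∈ ⋀[ℝ]^n (Module.Dual ℝ V) →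
      C n x → C (n + 1) (ι ℝ α * x))
    {n : ℕ} {x : EForm V} (hx : x ∈ ⋀[ℝ]^n (Module.Dual ℝ V)) : C n x := by
  induction hx using Submodule.pow_induction_on_left' with
  | algebraMap r => exact algebraMap r
  | add x y n _ _ hx hy => exact add n x y hx hy
  | mem_mul m hm n x hx h =>
    obtain ⟨α, rfl⟩ := hm
    exact ι_mul α n x hx h

lemma ι_mem_exteriorPower_one (α : Module.Dual ℝ V) :
    ι ℝ α ∈ ⋀[ℝ]^1 (Module.Dual ℝ V) := by
  rw [exteriorPower, pow_one]
  exact LinearMap.mem_range_self _ _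

lemma mul_mem_exteriorPower {m n : ℕ} {x y : EForm V} (hx : x ∈ ⋀[ℝ]^m (Module.Dual ℝ V))
    (hy : y ∈ ⋀[ℝ]^n (Module.Dual ℝ V)) : x * y ∈ ⋀[ℝ]^(m + n) (Module.Dual ℝ V) := by
  rw [exteriorPower, pow_add]
  exact Submodule.mul_mem_mul hx hy

lemma iContrL_mem_exteriorPower (X : V) {n : ℕ} {x : EForm V}
    (hx : x ∈ ⋀[ℝ]^(n + 1) (Module.Dual ℝ V)) :
    iContrL X x ∈ ⋀[ℝ]^n (Module.Dual ℝ V) := by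
  suffices h : ∀ n (x : EForm V), x ∈ ⋀[ℝ]^n (Module.Dual ℝ V) →
      (n = 0 → iContrL X x = 0) ∧ ∀ m, n = m + 1 → iContrL X x ∈ ⋀[ℝ]^m (Module.Dual ℝ V) from
    (h _ _ hx).2 n rfl
  intro n x hx
  refine mem_exteriorPower_induction (C := fun n x => (n = 0 → iContrL X x = 0) ∧
    ∀ m, n = m + 1 → iContrL X x ∈ ⋀[ℝ]^m (Module.Dual ℝ V)) ?_ ?_ ?_ hx
  · exact fun r => ⟨fun _ => iContrL_algebraMap X r, fun m hm => by omega⟩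
  · rintro n x y ⟨h0, h1⟩ ⟨k0, k1⟩
    refine ⟨fun h => by rw [map_add, h0 h, k0 h, add_zero], fun m hm => ?_⟩
    rw [map_add]
    exact add_mem (h1 m hm) (k1 m hm)
  · rintro α n x hx ⟨h0, h1⟩
    refine ⟨fun h => by omega, fun m hm => ?_⟩
    obtain rfl : n = m := by omega
    rw [iContrL_ι_mul]
    refine sub_mem (Submodule.smul_mem _ _ hx) ?_
    rcases n with _ | n
    · rw [h0 rfl, mul_zero]
      exact zero_mem _
    · rw [add_comm n 1]
      exact mul_mem_exteriorPower (ι_mem_exteriorPower_one α) (h1 n rfl)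

/-- Contraction is a graded derivation. -/
lemma iContrL_mul (X : V) {n : ℕ} {x : EForm V} (hx : x ∈ ⋀[ℝ]^n (Module.Dual ℝ V))
    (y : EForm V) :
    iContrL X (x * y) = iContrL X x * y + (-1 : ℝ) ^ n • (x * iContrL X y) := by
  refine mem_exteriorPower_induction (C := fun n x =>
    iContrL X (x * y) = iContrL X x * y + (-1 : ℝ) ^ n • (x * iContrL X y)) ?_ ?_ ?_ hx
  · intro r
    simp [iContrL_algebraMap, ← Algebra.smul_def]
  · intro n x z hx hz
    rw [add_mul, map_add, hx, hz, map_add, add_mul, add_mul, smul_add]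
    abel
  · intro α n x _ h
    rw [mul_assoc, iContrL_ι_mul, h, iContrL_ι_mul, mul_add, sub_mul, smul_mul_assoc, mul_smul_comm,
      pow_succ, mul_assoc, mul_assoc]
    module

/-- The wedge product is graded commutative. -/
lemma ι_mul_comm {n : ℕ} {x : EForm V} (hx : x ∈ ⋀[ℝ]^n (Module.Dual ℝ V))
    (α : Module.Dual ℝ V) : x * ι ℝ α = (-1 : ℝ) ^ n • (ι ℝ α * x) := by
  refine mem_exteriorPower_induction (C := fun n x =>
    x * ι ℝ α = (-1 : ℝ) ^ n • (ι ℝ α * x)) ?_ ?_ ?_ hx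
  · intro r
    simpa using Algebra.commutes r (ι ℝ α)
  · intro n x z hx hz
    rw [add_mul, hx, hz, mul_add, smul_add]
  · intro β n x _ h
    rw [mul_assoc, h, mul_smul_comm, ← mul_assoc, ← mul_assoc,
      eq_neg_of_add_eq_zero_left (ι_add_mul_swap β α), pow_succ, neg_mul, smul_neg]
    module

lemma exteriorPower_mul_comm {m n : ℕ} {x y : EForm V} (hx : x ∈ ⋀[ℝ]^m (Module.Dual ℝ V))
    (hy : y ∈ ⋀[ℝ]^n (Module.Dual ℝ V)) : x * y = (-1 : ℝ) ^ (m * n) • (y * x) := by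
  refine mem_exteriorPower_induction (C := fun m x =>
    x * y = (-1 : ℝ) ^ (m * n) • (y * x)) ?_ ?_ ?_ hx
  · intro r
    simpa using Algebra.commutes r y
  · intro n x z hx hz
    rw [add_mul, hx, hz, mul_add, smul_add]
  · intro β m x _ h
    have hs : ((-1 : ℝ) ^ n) * (-1) ^ n = 1 := by rw [← mul_pow]; simp
    rw [mul_assoc, h, mul_smul_comm, ← mul_assoc, ← mul_assoc, ι_mul_comm hy, smul_mul_assoc,
      smul_smul, add_mul, pow_add, one_mul, mul_assoc ((-1 : ℝ) ^ (m * n)), hs, mul_one]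

lemma exteriorPower_two_mul_comm {x : EForm V} (hx : x ∈ ⋀[ℝ]^2 (Module.Dual ℝ V))
    {n : ℕ} {y : EForm V} (hy : y ∈ ⋀[ℝ]^n (Module.Dual ℝ V)) : x * y = y * x := by
  simpa [pow_mul] using exteriorPower_mul_comm hx hy

/-- Euler's formula. -/
lemma sum_coord_mul_iContrL {I : Type} [Fintype I] (f : Module.Basis I ℝ V) {n : ℕ} {x : EForm V}
    (hx : x ∈ ⋀[ℝ]^n (Module.Dual ℝ V)) :
    ∑ i, ι ℝ (f.coord i) * iContrL (f i) x = (n : ℝ) • x := by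
  refine mem_exteriorPower_induction (C := fun n x =>
    ∑ i, ι ℝ (f.coord i) * iContrL (f i) x = (n : ℝ) • x) ?_ ?_ ?_ hx
  · intro r
    simp [iContrL_algebraMap]
  · intro n x y hx hy
    simp only [map_add, mul_add, Finset.sum_add_distrib, hx, hy, smul_add]
  · intro α n x _ h
    have hα : ∑ i, α (f i) • ι ℝ (f.coord i) = ι ℝ α := by
      simp only [← map_smul, ← map_sum]
      congr 1
      refine f.ext fun j => ?_
      simp
    have hs : ∀ i, ι ℝ (f.coord i) * (ι ℝ α * iContrL (f i) x) =
        -(ι ℝ α * (ι ℝ (f.coord i) * iContrL (f i) x)) := fun i => by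
      rw [← mul_assoc, eq_neg_of_add_eq_zero_left (ι_add_mul_swap (f.coord i) α), neg_mul,
        mul_assoc]
    simp only [iContrL_ι_mul, mul_sub, mul_smul_comm, hs, sub_neg_eq_add, Finset.sum_add_distrib,
      ← smul_mul_assoc, ← Finset.sum_mul, ← Finset.mul_sum, hα, h]
    push_cast
    simp only [smul_mul_assoc]
    module

lemma formToBilin_apply (η : EForm V) (X Y : V) :
    formToBilin η X Y = algebraMapInv (iContrL Y (iContrL X η)) := rfl

lemma exteriorPower_zero_eq {x : EForm V} (hx : x ∈ ⋀[ℝ]^0 (Module.Dual ℝ V)) :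
    x = algebraMap ℝ (EForm V) (algebraMapInv x) := by
  rw [exteriorPower, pow_zero] at hx
  obtain ⟨r, rfl⟩ := Submodule.mem_one.mp hx
  rw [algebraMap_leftInverse]

lemma iContrL_eq_ι_formToBilin (X : V) {η : EForm V} (hη : η ∈ ⋀[ℝ]^2 (Module.Dual ℝ V)) :
    iContrL X η = ι ℝ (formToBilin η X) := by
  have h := iContrL_mem_exteriorPower X hη
  rw [exteriorPower, pow_one] at h
  obtain ⟨α, hα⟩ := h
  rw [← hα]
  congr 1
  ext Y
  rw [formToBilin_apply, ← hα, iContrL_ι, algebraMap_leftInverse]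

end Contraction

section SixDimensional

lemma exteriorPower_seven_eq_zero {x : EForm (Fin 6 → ℝ)}
    (hx : x ∈ ⋀[ℝ]^7 (Module.Dual ℝ (Fin 6 → ℝ))) : x = 0 := by
  rw [← ιMulti_span_fixedDegree] at hx
  induction hx using Submodule.span_induction with
  | mem x hx =>
    obtain ⟨v, rfl⟩ := hx
    refine AlternatingMap.map_linearDependent _ v fun h => ?_
    have := h.fintype_card_le_finrank
    simp [Subspace.dual_finrank_eq] at this
  | zero => rfl
  | add x y _ _ hx hy => rw [hx, hy, add_zero]
  | smul r x _ hx => rw [hx, smul_zero]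

lemma e6_mem (i : Fin 6) : e6 i ∈ ⋀[ℝ]^1 (Module.Dual ℝ (Fin 6 → ℝ)) :=
  ι_mem_exteriorPower_one _

lemma vol6_mem : vol6 ∈ ⋀[ℝ]^6 (Module.Dual ℝ (Fin 6 → ℝ)) :=
  mul_mem_exteriorPower (mul_mem_exteriorPower (mul_mem_exteriorPower (mul_mem_exteriorPower
    (mul_mem_exteriorPower (e6_mem 0) (e6_mem 1)) (e6_mem 2)) (e6_mem 3)) (e6_mem 4)) (e6_mem 5)

/-- The coefficient of `vol6` in a form. -/
def topCoeff : EForm (Fin 6 → ℝ) →ₗ[ℝ] ℝ :=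
  (algebraMapInv : EForm (Fin 6 → ℝ) →ₐ[ℝ] ℝ).toLinearMap ∘ₗ
    iContrL (Pi.single 5 1) ∘ₗ iContrL (Pi.single 4 1) ∘ₗ iContrL (Pi.single 3 1) ∘ₗ
    iContrL (Pi.single 2 1) ∘ₗ iContrL (Pi.single 1 1) ∘ₗ iContrL (Pi.single 0 1)

lemma topCoeff_vol6 : topCoeff vol6 = 1 := by
  simp [topCoeff, vol6, e6, mul_assoc, iContrL_ι_mul, iContrL_ι]

lemma ι_mul_iContrL_of_mem {x : EForm (Fin 6 → ℝ)}
    (hx : x ∈ ⋀[ℝ]^6 (Module.Dual ℝ (Fin 6 → ℝ))) (α : Module.Dual ℝ (Fin 6 → ℝ))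
    (X : Fin 6 → ℝ) : ι ℝ α * iContrL X x = α X • x := by
  have h := exteriorPower_seven_eq_zero (mul_mem_exteriorPower (ι_mem_exteriorPower_one α) hx)
  have h2 := iContrL_ι_mul X α x
  rw [h, map_zero] at h2
  exact (sub_eq_zero.mp h2.symm).symm

variable {ω : EForm (Fin 6 → ℝ)} {K : (Fin 6 → ℝ) →ₗ[ℝ] (Fin 6 → ℝ)}

lemma ι_mul_iContrL_mul (hK : ∀ X : Fin 6 → ℝ, iContrL X ω * ω = iContrL (K X) vol6)
    (α : Module.Dual ℝ (Fin 6 → ℝ)) (X : Fin 6 → ℝ) :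
    ι ℝ α * (iContrL X ω * ω) = α (K X) • vol6 := by
  rw [hK, ι_mul_iContrL_of_mem vol6_mem]

lemma iContrL_swap (X Y : Fin 6 → ℝ) :
    formToBilin (iContrL X ω) Y = -formToBilin (iContrL Y ω) X := by
  refine LinearMap.ext fun Z => ?_
  simp only [formToBilin_apply, LinearMap.neg_apply, iContrL_comm Y X ω, map_neg]

lemma formToBilin_swap (η : EForm (Fin 6 → ℝ)) (X Y : Fin 6 → ℝ) :
    formToBilin η X Y = -formToBilin η Y X := by
  simp only [formToBilin_apply, iContrL_comm Y X η, map_neg]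

lemma pfaffian_endomorphism_symm (hω : ω ∈ ⋀[ℝ]^3 (Module.Dual ℝ (Fin 6 → ℝ)))
    (hK : ∀ X : Fin 6 → ℝ, iContrL X ω * ω = iContrL (K X) vol6) (X Y : Fin 6 → ℝ) :
    formToBilin (iContrL (K X) ω) Y = formToBilin (iContrL X ω) (K Y) := by
  have key : ∀ X Y Z : Fin 6 → ℝ, formToBilin (iContrL Y ω) Z (K X) +
      formToBilin (iContrL X ω) Z (K Y) +
      topCoeff (iContrL X ω * iContrL Y ω * iContrL Z ω) = 0 := by
    intro X Y Z
    have hX := iContrL_mem_exteriorPower X hω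
    have hY := iContrL_mem_exteriorPower Y hω
    have h := exteriorPower_seven_eq_zero (mul_mem_exteriorPower hY (mul_mem_exteriorPower hX hω))
    have h2 := congrArg (iContrL Z) h
    rw [iContrL_mul Z hY, iContrL_mul Z hX, map_zero, iContrL_eq_ι_formToBilin Z hY,
      iContrL_eq_ι_formToBilin Z hX, ι_mul_iContrL_mul hK, mul_add, ← mul_assoc (iContrL Y ω),
      exteriorPower_two_mul_comm hY (ι_mem_exteriorPower_one _), mul_assoc,
      ι_mul_iContrL_mul hK, mul_smul_comm, ← mul_assoc, exteriorPower_two_mul_comm hY hX] at h2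
    have h3 := congrArg topCoeff h2
    simp only [map_add, map_smul, topCoeff_vol6, map_zero] at h3
    simpa [add_assoc] using h3
  have hS : ∀ X Y Z : Fin 6 → ℝ, topCoeff (iContrL X ω * iContrL Y ω * iContrL Z ω) =
      topCoeff (iContrL Y ω * iContrL Z ω * iContrL X ω) := fun X Y Z => by
    rw [mul_assoc, exteriorPower_two_mul_comm (iContrL_mem_exteriorPower X hω)
      (mul_mem_exteriorPower (iContrL_mem_exteriorPower Y hω) (iContrL_mem_exteriorPower Z hω))]
  refine LinearMap.ext fun Z => ?_
  have h1 := key X Y Z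
  have h2 := key Y Z X
  have h3 := key Z X Y
  have s1 := hS X Y Z
  have s2 := hS Y Z X
  have sw : ∀ A B C, formToBilin (iContrL A ω) B C = -formToBilin (iContrL B ω) A C :=
    fun A B C => by rw [iContrL_swap]; rfl
  have sw' := fun A => formToBilin_swap (iContrL A ω)
  rw [sw, sw' Y, sw' X (K Y) Z, neg_neg]
  linarith [sw Z X (K Y), sw Y Z (K X), sw X Y (K Z)]

lemma ι_mul_ι_mul_contractions (hω : ω ∈ ⋀[ℝ]^3 (Module.Dual ℝ (Fin 6 → ℝ)))
    (hK : ∀ X : Fin 6 → ℝ, iContrL X ω * ω = iContrL (K X) vol6)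
    (α β : Module.Dual ℝ (Fin 6 → ℝ)) (X Y : Fin 6 → ℝ) :
    topCoeff (ι ℝ β * (ι ℝ α * (ι ℝ (formToBilin (iContrL X ω) Y) * ω))) +
      topCoeff (ι ℝ β * (ι ℝ α * (iContrL X ω * iContrL Y ω))) =
    α Y * β (K X) - α (K X) * β Y := by
  have hX := iContrL_mem_exteriorPower X hω
  have h := congrArg (iContrL Y) (ι_mul_iContrL_mul hK α X)
  rw [iContrL_ι_mul, iContrL_mul Y hX, iContrL_eq_ι_formToBilin Y hX, map_smul] at h
  have h2 := congrArg (fun x => topCoeff (ι ℝ β * x)) h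
  simp only [mul_sub, mul_add, mul_smul_comm, ι_mul_iContrL_mul hK, map_sub, map_add, map_smul,
    ι_mul_iContrL_of_mem vol6_mem, topCoeff_vol6, smul_eq_mul] at h2
  linarith

lemma pfaffian_endomorphism_sq (hω : ω ∈ ⋀[ℝ]^3 (Module.Dual ℝ (Fin 6 → ℝ)))
    (hK : ∀ X : Fin 6 → ℝ, iContrL X ω * ω = iContrL (K X) vol6) (X : Fin 6 → ℝ) :
    K (K X) = ((1/6 : ℝ) * LinearMap.trace ℝ (Fin 6 → ℝ) (K ∘ₗ K)) • X := by
  have key : ∀ (α β : Module.Dual ℝ (Fin 6 → ℝ)) (X Y : Fin 6 → ℝ),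
      α (K (K X)) * β Y - α Y * β (K (K X)) + α (K (K Y)) * β X - α X * β (K (K Y)) = 0 := by
    intro α β X Y
    have h1 := ι_mul_ι_mul_contractions hω hK α β (K X) Y
    have h2 := ι_mul_ι_mul_contractions hω hK α β (K Y) X
    have h3 := ι_mul_ι_mul_contractions hω hK α β X (K Y)
    have h4 := ι_mul_ι_mul_contractions hω hK α β Y (K X)
    have hc : ∀ X Y, iContrL X ω * iContrL Y ω = iContrL Y ω * iContrL X ω := fun X Y =>
      exteriorPower_two_mul_comm (iContrL_mem_exteriorPower X hω) (iContrL_mem_exteriorPower Y hω)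
    rw [pfaffian_endomorphism_symm hω hK] at h1 h2
    rw [iContrL_swap Y] at h2 h4
    rw [pfaffian_endomorphism_symm hω hK] at h2 h4
    rw [hc _ X] at h2
    rw [hc Y] at h4
    simp only [map_neg, neg_mul, mul_neg] at h2 h4
    linarith
  have hs : ∀ (γ : Module.Dual ℝ (Fin 6 → ℝ)) (Z : Fin 6 → ℝ),
      ∑ i, γ (Pi.single i 1) * Z i = γ Z := fun γ Z => by
    rw [γ.pi_apply_eq_sum_univ Z]
    exact Finset.sum_congr rfl fun i _ => by
      rw [smul_eq_mul, mul_comm]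
      congr 2
      ext j
      simp [Pi.single_apply, eq_comm]
  have htr : ∑ i, K (K (Pi.single i 1)) i = LinearMap.trace ℝ (Fin 6 → ℝ) (K ∘ₗ K) := by
    rw [LinearMap.trace_eq_matrix_trace ℝ (Pi.basisFun ℝ (Fin 6)), Matrix.trace]
    simp
  ext j
  let α : Module.Dual ℝ (Fin 6 → ℝ) := LinearMap.proj j
  have h := Finset.sum_congr rfl fun i (_ : i ∈ Finset.univ) =>
    key α (LinearMap.proj i) X (Pi.single i 1)
  simp only [LinearMap.proj_apply, Finset.sum_add_distrib, Finset.sum_sub_distrib,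
    ← Finset.mul_sum, htr, hs α (K (K X)), Pi.single_eq_same,
    Finset.sum_const_zero] at h
  have h6 := hs (α ∘ₗ K ∘ₗ K) X
  simp only [LinearMap.comp_apply] at h6
  rw [h6] at h
  simp [α] at h
  simp
  linarith

lemma trace_pfaffian_endomorphism (hω : ω ∈ ⋀[ℝ]^3 (Module.Dual ℝ (Fin 6 → ℝ)))
    (hK : ∀ X : Fin 6 → ℝ, iContrL X ω * ω = iContrL (K X) vol6) :
    LinearMap.trace ℝ (Fin 6 → ℝ) K = 0 := by
  have h := sum_coord_mul_iContrL (Pi.basisFun ℝ (Fin 6)) hω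
  have h2 := congrArg (fun x => topCoeff (x * ω)) h
  have hωω : ω * ω = 0 := by
    have := exteriorPower_mul_comm hω hω
    norm_num at this
    have h0 : (2 : ℝ) • (ω * ω) = 0 := by
      rw [two_smul]
      nth_rewrite 1 [this]
      exact neg_add_cancel _
    exact (smul_eq_zero.mp h0).resolve_left two_ne_zero
  simp only [Finset.sum_mul, mul_assoc, ι_mul_iContrL_mul hK, smul_mul_assoc, hωω, smul_zero,
    map_zero, map_sum, map_smul, topCoeff_vol6] at h2
  rw [LinearMap.trace_eq_matrix_trace ℝ (Pi.basisFun ℝ (Fin 6)), Matrix.trace]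
  simpa [LinearMap.toMatrix_apply] using h2

end SixDimensional

section Orbit

lemma iContrL_triple_mul_self {V : Type} [AddCommGroup V] [Module ℝ V] (X : V)
    (a b c : Module.Dual ℝ V) :
    iContrL X (ι ℝ a * ι ℝ b * ι ℝ c) * (ι ℝ a * ι ℝ b * ι ℝ c) = 0 := by
  have sq : ∀ (a : Module.Dual ℝ V) x, ι ℝ a * (ι ℝ a * x) = 0 := fun a x => by
    rw [← mul_assoc, ι_sq_zero, zero_mul]
  have sw : ∀ (a b : Module.Dual ℝ V) x, ι ℝ a * (ι ℝ b * x) = -(ι ℝ b * (ι ℝ a * x)) :=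
    fun a b x => by
      rw [← mul_assoc, eq_neg_of_add_eq_zero_left (ι_add_mul_swap a b), neg_mul, mul_assoc]
  simp only [mul_assoc, iContrL_ι_mul, iContrL_ι, ← Algebra.commutes, ← Algebra.smul_def, sub_mul,
    mul_sub, smul_mul_assoc, mul_smul_comm]
  simp [sq, sw b a, sw c a, sw c b]

lemma sum_triple_products {V : Type} [AddCommGroup V] [Module ℝ V] (p : Fin 3 → Module.Dual ℝ V)
    (s : Fin 3 → Fin 3 → Fin 3 → ℝ) (h1 : ∀ i j k, s i j k = -s j i k)
    (h2 : ∀ i j k, s i j k = -s i k j) :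
    ∑ i, ∑ j, ∑ k, s i j k • (ι ℝ (p i) * (ι ℝ (p j) * ι ℝ (p k))) =
      (6 * s 0 1 2) • (ι ℝ (p 0) * ι ℝ (p 1) * ι ℝ (p 2)) := by
  have sq : ∀ (a : Module.Dual ℝ V) x, ι ℝ a * (ι ℝ a * x) = 0 := fun a x => by
    rw [← mul_assoc, ι_sq_zero, zero_mul]
  have sw0 : ∀ a b : Module.Dual ℝ V, ι ℝ a * ι ℝ b = -(ι ℝ b * ι ℝ a) :=
    fun a b => eq_neg_of_add_eq_zero_left (ι_add_mul_swap a b)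
  have sw : ∀ (a b : Module.Dual ℝ V) x, ι ℝ a * (ι ℝ b * x) = -(ι ℝ b * (ι ℝ a * x)) :=
    fun a b x => by rw [← mul_assoc, sw0, neg_mul, mul_assoc]
  have s021 : s 0 2 1 = -s 0 1 2 := h2 _ _ _
  have s102 : s 1 0 2 = -s 0 1 2 := h1 _ _ _
  have s120 : s 1 2 0 = s 0 1 2 := by rw [h2, h1, neg_neg]
  have s201 : s 2 0 1 = s 0 1 2 := by rw [h1, h2, neg_neg]
  have s210 : s 2 1 0 = -s 0 1 2 := by rw [h1, h2, h1, neg_neg]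
  simp only [Fin.sum_univ_three, mul_assoc, sq, ι_sq_zero, s021, s102, s120, s201, s210,
    sw (p 1) (p 0), sw (p 2) (p 0), sw (p 2) (p 1), sw0 (p 1) (p 0), sw0 (p 2) (p 0),
    sw0 (p 2) (p 1), mul_neg, mul_zero, neg_zero, neg_neg, smul_zero, add_zero, zero_add]
  module

lemma formPullback_e6 (g : (Fin 6 → ℝ) →ₗ[ℝ] (Fin 6 → ℝ)) (i : Fin 6) :
    formPullback g (e6 i) = ι ℝ ((LinearMap.proj i : (Fin 6 → ℝ) →ₗ[ℝ] ℝ) ∘ₗ g) := by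
  rw [formPullback, e6, lift_ι_apply]
  rfl

lemma topCoeff_ne_zero (b : Module.Basis (Fin 6) ℝ (Module.Dual ℝ (Fin 6 → ℝ))) :
    topCoeff (ι ℝ (b 0) * ι ℝ (b 1) * ι ℝ (b 2) * (ι ℝ (b 3) * ι ℝ (b 4) * ι ℝ (b 5))) ≠ 0 := by
  intro h
  let F := topCoeff.compAlternatingMap (ιMulti ℝ (M := Module.Dual ℝ (Fin 6 → ℝ)) 6)
  have hF : ∀ v, F v = topCoeff (ι ℝ (v 0) * ι ℝ (v 1) * ι ℝ (v 2) *
      (ι ℝ (v 3) * ι ℝ (v 4) * ι ℝ (v 5))) := fun v => by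
    simp only [F, LinearMap.compAlternatingMap_apply, ιMulti_apply, List.ofFn_succ, List.ofFn_zero,
      List.prod_cons, List.prod_nil, mul_one, mul_assoc]
    rfl
  have h0 : F = 0 := (AlternatingMap.map_basis_eq_zero_iff b F).mp (by rw [hF, h])
  have h1 := hF (fun i => (Pi.basisFun ℝ (Fin 6)).coord i)
  have h2 := topCoeff_vol6
  rw [vol6] at h2
  simp only [e6, mul_assoc] at h2
  rw [h0] at h1
  simp only [mul_assoc, h2] at h1
  exact zero_ne_one h1

variable {ω : EForm (Fin 6 → ℝ)} {K : (Fin 6 → ℝ) →ₗ[ℝ] (Fin 6 → ℝ)}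

lemma pfaffian_endomorphism_eq_smul (hK : ∀ X : Fin 6 → ℝ, iContrL X ω * ω = iContrL (K X) vol6)
    {x : EForm (Fin 6 → ℝ)} (hx : x ∈ ⋀[ℝ]^6 (Module.Dual ℝ (Fin 6 → ℝ))) {X : Fin 6 → ℝ}
    (h : iContrL X ω * ω = iContrL X x) : K X = topCoeff x • X := by
  ext i
  have h1 := ι_mul_iContrL_mul hK (LinearMap.proj i) X
  rw [h, ι_mul_iContrL_of_mem hx] at h1
  have h2 := congrArg topCoeff h1
  rw [map_smul, map_smul, topCoeff_vol6] at h2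
  simp only [LinearMap.proj_apply, smul_eq_mul, mul_one] at h2
  rw [← h2, Pi.smul_apply, smul_eq_mul, mul_comm]

lemma pfaffian_pos_of_orbit (hK : ∀ X : Fin 6 → ℝ, iContrL X ω * ω = iContrL (K X) vol6)
    (g : (Fin 6 → ℝ) ≃ₗ[ℝ] (Fin 6 → ℝ))
    (hg : ω = formPullback (g : (Fin 6 → ℝ) →ₗ[ℝ] (Fin 6 → ℝ)) omegaModel) :
    0 < (1/6 : ℝ) * LinearMap.trace ℝ (Fin 6 → ℝ) (K ∘ₗ K) := by
  let f : Module.Basis (Fin 6) ℝ (Fin 6 → ℝ) := Module.Basis.ofEquivFun g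
  have hf : ∀ i, ((LinearMap.proj i : (Fin 6 → ℝ) →ₗ[ℝ] ℝ) ∘ₗ
      (g : (Fin 6 → ℝ) →ₗ[ℝ] (Fin 6 → ℝ))) = f.coord i := fun i => rfl
  set A := ι ℝ (f.coord 0) * ι ℝ (f.coord 1) * ι ℝ (f.coord 2) with hA
  set B := ι ℝ (f.coord 3) * ι ℝ (f.coord 4) * ι ℝ (f.coord 5) with hB
  have hω : ω = A + B := by
    simp only [hg, omegaModel, map_add, map_mul, formPullback_e6, hf, hA, hB]
  have hA3 : A ∈ ⋀[ℝ]^3 (Module.Dual ℝ (Fin 6 → ℝ)) :=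
    mul_mem_exteriorPower (mul_mem_exteriorPower (ι_mem_exteriorPower_one _)
      (ι_mem_exteriorPower_one _)) (ι_mem_exteriorPower_one _)
  have hB3 : B ∈ ⋀[ℝ]^3 (Module.Dual ℝ (Fin 6 → ℝ)) :=
    mul_mem_exteriorPower (mul_mem_exteriorPower (ι_mem_exteriorPower_one _)
      (ι_mem_exteriorPower_one _)) (ι_mem_exteriorPower_one _)
  have hAB := mul_mem_exteriorPower hA3 hB3
  have hd : topCoeff (A * B) ≠ 0 := by
    simpa [hA, hB] using topCoeff_ne_zero f.dualBasis
  set d := topCoeff (A * B)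
  have hAA : ∀ X, iContrL X A * A = 0 := fun X => iContrL_triple_mul_self X _ _ _
  have hBB : ∀ X, iContrL X B * B = 0 := fun X => iContrL_triple_mul_self X _ _ _
  have hpos : ∀ X, iContrL X B = 0 → K X = d • X := fun X hX =>
    pfaffian_endomorphism_eq_smul hK hAB <| by
      simp [hω, mul_add, hX, hAA, iContrL_mul X hA3]
  have hneg : ∀ X, iContrL X A = 0 → K X = -d • X := fun X hX => by
    rw [pfaffian_endomorphism_eq_smul hK (neg_mem hAB), map_neg]
    rw [hω, map_add, hX, zero_add, mul_add, hBB, map_neg, iContrL_mul X hA3, hX,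
      exteriorPower_two_mul_comm (iContrL_mem_exteriorPower X hB3) hA3]
    norm_num
  have hfc : ∀ i j, f.coord i (f j) = if j = i then 1 else 0 := fun i j => by
    simp [Finsupp.single_apply]
  have hKK : K ∘ₗ K = (d * d) • LinearMap.id := by
    refine f.ext fun i => ?_
    have h : K (f i) = d • f i ∨ K (f i) = -d • f i := by
      fin_cases i
      · exact .inl (hpos _ (by simp [hB, mul_assoc, iContrL_ι_mul, iContrL_ι, hfc]))
      · exact .inl (hpos _ (by simp [hB, mul_assoc, iContrL_ι_mul, iContrL_ι, hfc]))
      · exact .inl (hpos _ (by simp [hB, mul_assoc, iContrL_ι_mul, iContrL_ι, hfc]))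
      · exact .inr (hneg _ (by simp [hA, mul_assoc, iContrL_ι_mul, iContrL_ι, hfc]))
      · exact .inr (hneg _ (by simp [hA, mul_assoc, iContrL_ι_mul, iContrL_ι, hfc]))
      · exact .inr (hneg _ (by simp [hA, mul_assoc, iContrL_ι_mul, iContrL_ι, hfc]))
    rcases h with h | h <;> simp [h, smul_smul]
  rw [hKK, map_smul, LinearMap.trace_id]
  simp only [Module.finrank_fin_fun, smul_eq_mul]
  have := mul_self_pos.mpr hd
  push_cast
  linarith

/-- An involution up to scale with trace zero has an adapted eigenbasis. -/
lemma exists_eigenbasis {c : ℝ} (hc : c ≠ 0) (hKK : ∀ X, K (K X) = (c * c) • X)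
    (htr : LinearMap.trace ℝ (Fin 6 → ℝ) K = 0) :
    ∃ f : Module.Basis (Fin 3 ⊕ Fin 3) ℝ (Fin 6 → ℝ),
      (∀ i, K (f (.inl i)) = c • f (.inl i)) ∧ ∀ i, K (f (.inr i)) = -c • f (.inr i) := by
  let P : (Fin 6 → ℝ) →ₗ[ℝ] (Fin 6 → ℝ) := (1 / 2 : ℝ) • (LinearMap.id + c⁻¹ • K)
  have hP : ∀ X, P X = (1 / 2 : ℝ) • (X + c⁻¹ • K X) := fun X => rfl
  have hKP : ∀ X, K (P X) = c • P X := fun X => by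
    simp only [hP, map_smul, map_add, hKK, smul_add, smul_smul]
    rw [add_comm]
    congr 2 <;> field_simp
  have hPP : IsIdempotentElem P := by
    refine LinearMap.ext fun X => ?_
    rw [Module.End.mul_apply, hP (P X), hKP, smul_smul, inv_mul_cancel₀ hc]
    module
  have hproj := LinearMap.IsIdempotentElem.isProj_range P hPP
  have hrange : Module.finrank ℝ (LinearMap.range P) = 3 := by
    have h := hproj.trace
    simp only [P, map_smul, map_add, htr, LinearMap.trace_id, Module.finrank_fin_fun] at h
    norm_num at h
    exact_mod_cast h.symm
  have hker : Module.finrank ℝ (LinearMap.ker P) = 3 := by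
    have h := P.finrank_range_add_finrank_ker
    rw [hrange, Module.finrank_fin_fun] at h
    omega
  let f := ((Module.finBasisOfFinrankEq ℝ _ hrange).prod
    (Module.finBasisOfFinrankEq ℝ _ hker)).map
      (Submodule.prodEquivOfIsCompl _ _ hproj.isCompl)
  refine ⟨f, fun i => ?_, fun i => ?_⟩
  · have : f (.inl i) = Module.finBasisOfFinrankEq ℝ _ hrange i := by simp [f]
    rw [this]
    obtain ⟨Y, hY⟩ := (Module.finBasisOfFinrankEq ℝ _ hrange i).2
    rw [← hY, hKP]
  · have : f (.inr i) = Module.finBasisOfFinrankEq ℝ _ hker i := by simp [f]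
    rw [this]
    have h := (Module.finBasisOfFinrankEq ℝ _ hker i).2
    rw [LinearMap.mem_ker, hP] at h
    have h2 := (smul_eq_zero.mp h).resolve_left (by norm_num)
    have h3 := congrArg (fun x => c • x) h2
    simp only [smul_add, smul_smul, mul_inv_cancel₀ hc, one_smul, smul_zero] at h3
    rw [neg_smul]
    exact eq_neg_of_add_eq_zero_right h3

lemma eq_add_of_eigenbasis (hω : ω ∈ ⋀[ℝ]^3 (Module.Dual ℝ (Fin 6 → ℝ)))
    (hK : ∀ X : Fin 6 → ℝ, iContrL X ω * ω = iContrL (K X) vol6) {c : ℝ} (hc : c ≠ 0)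
    (f : Module.Basis (Fin 3 ⊕ Fin 3) ℝ (Fin 6 → ℝ))
    (hl : ∀ i, K (f (.inl i)) = c • f (.inl i)) (hr : ∀ i, K (f (.inr i)) = -c • f (.inr i)) :
    ∃ u v : ℝ, ω =
      u • (ι ℝ (f.coord (.inl 0)) * ι ℝ (f.coord (.inl 1)) * ι ℝ (f.coord (.inl 2))) +
      v • (ι ℝ (f.coord (.inr 0)) * ι ℝ (f.coord (.inr 1)) * ι ℝ (f.coord (.inr 2))) := by
  have hlr : ∀ i j, formToBilin (iContrL (f (.inl i)) ω) (f (.inr j)) = 0 := fun i j => by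
    have h := pfaffian_endomorphism_symm hω hK (f (.inl i)) (f (.inr j))
    rw [hl, hr] at h
    refine LinearMap.ext fun Z => ?_
    have h2 := LinearMap.congr_fun h Z
    simp only [formToBilin_apply, map_smul, LinearMap.smul_apply, smul_eq_mul] at h2
    rw [LinearMap.zero_apply, formToBilin_apply]
    have : (2 * c) * (algebraMapInv (iContrL Z (iContrL (f (.inr j)) (iContrL (f (.inl i)) ω))))
      = 0 := by linarith
    exact (mul_eq_zero.mp this).resolve_left (by simpa using hc)
  have hrl : ∀ i j, formToBilin (iContrL (f (.inr i)) ω) (f (.inl j)) = 0 := fun i j => by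
    rw [iContrL_swap, hlr, neg_zero]
  have hex : ω = (1 / 6 : ℝ) • ∑ i, ∑ j, ∑ k,
      formToBilin (iContrL (f i) ω) (f j) (f k) •
        (ι ℝ (f.coord i) * (ι ℝ (f.coord j) * ι ℝ (f.coord k))) := by
    have h3 : ∀ i j, iContrL (f j) (iContrL (f i) ω) =
        ∑ k, formToBilin (iContrL (f i) ω) (f j) (f k) • ι ℝ (f.coord k) := fun i j => by
      have hi := iContrL_mem_exteriorPower (f i) hω
      have h := sum_coord_mul_iContrL f (iContrL_mem_exteriorPower (f j) hi)
      rw [Nat.cast_one, one_smul] at h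
      rw [← h]
      refine Finset.sum_congr rfl fun k _ => ?_
      rw [iContrL_eq_ι_formToBilin _ hi, iContrL_ι, ← Algebra.commutes, ← Algebra.smul_def]
    have h2 : ∀ i, (2 : ℝ) • iContrL (f i) ω =
        ∑ j, ι ℝ (f.coord j) * iContrL (f j) (iContrL (f i) ω) := fun i => by
      simpa using (sum_coord_mul_iContrL f (iContrL_mem_exteriorPower (f i) hω)).symm
    have h1 : (6 : ℝ) • ω = ∑ i, ι ℝ (f.coord i) * ((2 : ℝ) • iContrL (f i) ω) := by
      simp only [mul_smul_comm, ← Finset.smul_sum]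
      rw [sum_coord_mul_iContrL f hω, smul_smul]
      norm_num
    simp only [h2, h3, Finset.mul_sum, mul_smul_comm] at h1
    rw [← h1, smul_smul]
    norm_num
  have hsw1 : ∀ i j k, formToBilin (iContrL (f i) ω) (f j) (f k) =
      -formToBilin (iContrL (f j) ω) (f i) (f k) := fun i j k => by
    rw [iContrL_swap]
    rfl
  have hsw2 : ∀ i j k, formToBilin (iContrL (f i) ω) (f j) (f k) =
      -formToBilin (iContrL (f i) ω) (f k) (f j) := fun i j k => formToBilin_swap _ _ _
  have hllr : ∀ i j k, formToBilin (iContrL (f (.inl i)) ω) (f (.inl j)) (f (.inr k)) = 0 :=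
    fun i j k => by rw [hsw2, hlr]; simp
  have hrrl : ∀ i j k, formToBilin (iContrL (f (.inr i)) ω) (f (.inr j)) (f (.inl k)) = 0 :=
    fun i j k => by rw [hsw2, hrl]; simp
  refine ⟨formToBilin (iContrL (f (.inl 0)) ω) (f (.inl 1)) (f (.inl 2)),
    formToBilin (iContrL (f (.inr 0)) ω) (f (.inr 1)) (f (.inr 2)), ?_⟩
  have hL := sum_triple_products (fun i => f.coord (.inl i))
    (fun i j k => formToBilin (iContrL (f (.inl i)) ω) (f (.inl j)) (f (.inl k)))
    (fun _ _ _ => hsw1 _ _ _) (fun _ _ _ => hsw2 _ _ _)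
  have hR := sum_triple_products (fun i => f.coord (.inr i))
    (fun i j k => formToBilin (iContrL (f (.inr i)) ω) (f (.inr j)) (f (.inr k)))
    (fun _ _ _ => hsw1 _ _ _) (fun _ _ _ => hsw2 _ _ _)
  refine hex.trans ?_
  simp only [Fintype.sum_sum_type, hlr, hrl, hllr, hrrl, LinearMap.zero_apply, zero_smul,
    Finset.sum_const_zero, add_zero, zero_add, hL, hR]
  module

lemma orbit_of_pfaffian_pos (hω : ω ∈ ⋀[ℝ]^3 (Module.Dual ℝ (Fin 6 → ℝ)))
    (hK : ∀ X : Fin 6 → ℝ, iContrL X ω * ω = iContrL (K X) vol6)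
    (hpos : 0 < (1/6 : ℝ) * LinearMap.trace ℝ (Fin 6 → ℝ) (K ∘ₗ K)) :
    ∃ g : (Fin 6 → ℝ) ≃ₗ[ℝ] (Fin 6 → ℝ), ω = formPullback (g : (Fin 6 → ℝ) →ₗ[ℝ] (Fin 6 → ℝ))
      omegaModel := by
  set l := (1/6 : ℝ) * LinearMap.trace ℝ (Fin 6 → ℝ) (K ∘ₗ K) with hl
  have hc : √l ≠ 0 := (Real.sqrt_pos.mpr hpos).ne'
  have hKK : ∀ X, K (K X) = (√l * √l) • X := fun X => by
    rw [Real.mul_self_sqrt hpos.le, hl, pfaffian_endomorphism_sq hω hK]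
  obtain ⟨f, hfl, hfr⟩ := exists_eigenbasis hc hKK (trace_pfaffian_endomorphism hω hK)
  obtain ⟨u, v, huv⟩ := eq_add_of_eigenbasis hω hK hc f hfl hfr
  have hne : ∀ i, iContrL (f i) ω ≠ 0 := fun i h => by
    have h0 : K (f i) = 0 := by
      rw [pfaffian_endomorphism_eq_smul hK (zero_mem _) (X := f i) (by rw [h]; simp)]
      simp
    have h1 := hKK (f i)
    rw [h0, map_zero] at h1
    exact (smul_ne_zero (mul_ne_zero hc hc) (f.ne_zero i)) h1.symm
  have hfc : ∀ i j, f.coord i (f j) = if j = i then 1 else 0 := fun i j => by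
    simp [Finsupp.single_apply]
  have hu : u ≠ 0 := by
    rintro rfl
    refine hne (.inl 0) ?_
    simp [huv, mul_assoc, iContrL_ι_mul, iContrL_ι, hfc]
  have hv : v ≠ 0 := by
    rintro rfl
    refine hne (.inr 0) ?_
    simp [huv, mul_assoc, iContrL_ι_mul, iContrL_ι, hfc]
  have hw : ∀ i, (![u, 1, 1, v, 1, 1] : Fin 6 → ℝ) i ≠ 0 := by
    intro i
    fin_cases i <;> simp [hu, hv]
  let g : (Fin 6 → ℝ) ≃ₗ[ℝ] (Fin 6 → ℝ) := (f.reindex finSumFinEquiv).equivFun ≪≫ₗ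
    LinearEquiv.piCongrRight fun i => LinearEquiv.smulOfNeZero ℝ ℝ _ (hw i)
  have hg : ∀ i, (LinearMap.proj i : (Fin 6 → ℝ) →ₗ[ℝ] ℝ) ∘ₗ
      (g : (Fin 6 → ℝ) →ₗ[ℝ] (Fin 6 → ℝ)) =
        (![u, 1, 1, v, 1, 1] : Fin 6 → ℝ) i • f.coord (finSumFinEquiv.symm i) := fun i =>
    LinearMap.ext fun X => by simp [g]
  refine ⟨g, ?_⟩
  have e0 : (finSumFinEquiv.symm (0 : Fin (3 + 3)) : Fin 3 ⊕ Fin 3) = .inl 0 := rfl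
  have e1 : (finSumFinEquiv.symm (1 : Fin (3 + 3)) : Fin 3 ⊕ Fin 3) = .inl 1 := rfl
  have e2 : (finSumFinEquiv.symm (2 : Fin (3 + 3)) : Fin 3 ⊕ Fin 3) = .inl 2 := rfl
  have e3 : (finSumFinEquiv.symm (3 : Fin (3 + 3)) : Fin 3 ⊕ Fin 3) = .inr 0 := rfl
  have e4 : (finSumFinEquiv.symm (4 : Fin (3 + 3)) : Fin 3 ⊕ Fin 3) = .inr 1 := rfl
  have e5 : (finSumFinEquiv.symm (5 : Fin (3 + 3)) : Fin 3 ⊕ Fin 3) = .inr 2 := rfl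
  simp only [omegaModel, map_add, map_mul, formPullback_e6, hg, e0, e1, e2, e3, e4, e5]
  simp [huv]

end Orbit

/-- On `ℝ⁶` with `θ = e₁* ∧ ⋯ ∧ e₆*`, a 3-form `ω` has Hitchin pfaffian `λ(ω) > 0` iff it
lies in the `GL(6,ℝ)`-orbit (pullback action) of `e₁* ∧ e₂* ∧ e₃* + e₄* ∧ e₅* ∧ e₆*`. -/
theorem pfaffian_pos_iff_orbit
    (ω : EForm (Fin 6 → ℝ)) (hω : ω ∈ ⋀[ℝ]^3 (Module.Dual ℝ (Fin 6 → ℝ)))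
    (K : (Fin 6 → ℝ) →ₗ[ℝ] (Fin 6 → ℝ))
    (hK : ∀ X : Fin 6 → ℝ, (iContrL X ω) * ω = iContrL (K X) vol6) :
    0 < (1/6 : ℝ) * LinearMap.trace ℝ (Fin 6 → ℝ) (K ∘ₗ K) ↔
      ∃ g : (Fin 6 → ℝ) ≃ₗ[ℝ] (Fin 6 → ℝ), ω = formPullback (g : (Fin 6 → ℝ) →ₗ[ℝ] (Fin 6 → ℝ))
        omegaModel := by
  exact ⟨orbit_of_pfaffian_pos hω hK, fun ⟨g, hg⟩ => pfaffian_pos_of_orbit hK g hg⟩
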